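/- Let n ≥ 2 and let p be a prime. For every x ∈ ℙ^{n-1}(ℚ_p) that does not lie in ℙ^{n-1}(ℚ) (i.e., x is not the class of a vector with rational coordinates), there exist infinitely many distinct points y ∈ ℙ^{n-1}(ℚ) such that δ_p(x, y) ≤ c(n)^{n/(n-1)} · H_e(y)^{-n/(n-1)}, where c(n) = 2·π^{-1/2}·Γ(n/2 + 1)^{1/n}. -/

import Mathlib

open MeasureTheory

noncomputable section

/-- The p-adic projective distance (at vector level): the sup-norm of the wedge product
divided by the product of sup norms.  Invariant under scaling, it descends to
projective space. -/
def padicDelta (p : ℕ) [Fact p.Prime] {n : ℕ} (x y : Fin n → ℚ_[p]) : ℝ :=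
  (⨆ ij : Fin n × Fin n, ‖x ij.1 * y ij.2 - x ij.2 * y ij.1‖) / (‖x‖ * ‖y‖)

instance (p : ℕ) [Fact p.Prime] (n : ℕ) : MeasurableSpace (Fin n → ℚ_[p]) := borel _
instance (p : ℕ) [Fact p.Prime] (n : ℕ) : BorelSpace (Fin n → ℚ_[p]) := ⟨rfl⟩

/-- `ℤ_p^n` as a positive compact subset of `ℚ_p^n`. -/
def padicUnitPC (p : ℕ) [Fact p.Prime] (n : ℕ) :
    TopologicalSpace.PositiveCompacts (Fin n → ℚ_[p]) where
  carrier := {x | ∀ i, ‖x i‖ ≤ 1}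
  isCompact' := by
    have : {x : Fin n → ℚ_[p] | ∀ i, ‖x i‖ ≤ 1} = Set.univ.pi fun _ => Metric.closedBall 0 1 := by
      ext x; simp [Metric.mem_closedBall, dist_eq_norm]
    rw [this]
    exact isCompact_univ_pi fun i => isCompact_closedBall 0 1
  interior_nonempty' := by
    refine ⟨0, ?_⟩
    rw [mem_interior]
    refine ⟨Metric.ball 0 1, fun x hx i => ?_, Metric.isOpen_ball, by simp⟩
    have hx' : ‖x‖ < 1 := by simpa [dist_eq_norm] using hx
    exact le_of_lt (lt_of_le_of_lt (norm_le_pi_norm x i) hx')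

/-- Haar measure on `ℚ_p^n`, normalized so that `ℤ_p^n` has measure one. -/
def padicHaar (p : ℕ) [Fact p.Prime] (n : ℕ) : Measure (Fin n → ℚ_[p]) :=
  Measure.addHaarMeasure (padicUnitPC p n)

/-- The natural probability measure `μ_p` on `ℙ^{n-1}(ℚ_p)`:
`μ_p(M) = β(φ⁻¹(M) ∩ ℤ_p^n)`. -/
def muP (p : ℕ) [Fact p.Prime] (n : ℕ)
    (M : Set (Projectivization ℚ_[p] (Fin n → ℚ_[p]))) : ENNReal :=
  padicHaar p n {x | (∀ i, ‖x i‖ ≤ 1) ∧ ∃ hx : x ≠ 0, Projectivization.mk ℚ_[p] x hx ∈ M}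

/-- A visible (primitive) integer vector: the gcd of its coordinates is 1. -/
def IsPrim {n : ℕ} (v : Fin n → ℤ) : Prop := Finset.univ.gcd v = 1

/-- The sup-norm height of an integer vector. -/
def Hsup {n : ℕ} (v : Fin n → ℤ) : ℕ := Finset.univ.sup fun i => (v i).natAbs

/-- Embedding of an integer vector into `ℚ_p^n`. -/
def intPadic (p : ℕ) [Fact p.Prime] {n : ℕ} (v : Fin n → ℤ) : Fin n → ℚ_[p] :=
  fun i => ((v i : ℤ) : ℚ_[p])

/-- Embedding of an integer vector into `ℚ^n`. -/
def intRat {n : ℕ} (v : Fin n → ℤ) : Fin n → ℚ := fun i => ((v i : ℤ) : ℚ)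

/-- The set `W_p(ψ, ℚ, n)` of points of `ℙ^{n-1}(ℚ_p)` admitting infinitely many
rational approximations `y` with `δ_p(x,y) ≤ ψ(H(y))`. -/
def Wp (p : ℕ) [Fact p.Prime] (n : ℕ) (ψ : ℕ → ℝ) :
    Set (Projectivization ℚ_[p] (Fin n → ℚ_[p])) :=
  {x | {y : Projectivization ℚ (Fin n → ℚ) | ∃ v : Fin n → ℤ, IsPrim v ∧
      (∃ hv : intRat v ≠ 0, y = Projectivization.mk ℚ (intRat v) hv) ∧
      padicDelta p x.rep (intPadic p v) ≤ ψ (Hsup v)}.Infinite}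

/-- Closed ball for the projective metric, centered at the class of the vector `y`. -/
def Bdelta (p : ℕ) [Fact p.Prime] {n : ℕ} (y : Fin n → ℚ_[p]) (r : ℝ) :
    Set (Projectivization ℚ_[p] (Fin n → ℚ_[p])) :=
  {z | padicDelta p z.rep y ≤ r}

/-- The Euclidean norm of a vector in `ℝ^n`. -/
noncomputable def eNorm {n : ℕ} (x : Fin n → ℝ) : ℝ := Real.sqrt (∑ i, (x i) ^ 2)

/-- Norm of the wedge product of two vectors in `ℝ^n`:
`‖x ∧ y‖² = Σ_{i<j} (x_i y_j − x_j y_i)²`. -/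
noncomputable def wedgeNorm {n : ℕ} (x y : Fin n → ℝ) : ℝ :=
  Real.sqrt (∑ ij ∈ Finset.univ.filter (fun ij : Fin n × Fin n => ij.1 < ij.2),
    (x ij.1 * y ij.2 - x ij.2 * y ij.1) ^ 2)

/-- The projective distance at the infinite place (vector level):
`δ_∞(x,y) = ‖x ∧ y‖ / (‖x‖‖y‖)`. Invariant under scaling, it descends to `ℙ^{n-1}(ℝ)`. -/
noncomputable def deltaInf {n : ℕ} (x y : Fin n → ℝ) : ℝ :=
  wedgeNorm x y / (eNorm x * eNorm y)

/-- Embedding of an integer vector into `ℝ^n`. -/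
noncomputable def intReal {n : ℕ} (v : Fin n → ℤ) : Fin n → ℝ := fun i => ((v i : ℤ) : ℝ)

/-- The natural probability measure `μ_∞` on `ℙ^{n-1}(ℝ)`:
`μ_∞(M) = λ(φ⁻¹(M) ∩ B(0,1)) / λ(B(0,1))`. -/
noncomputable def muInf (n : ℕ) (M : Set (Projectivization ℝ (Fin n → ℝ))) : ENNReal :=
  MeasureTheory.volume {x : Fin n → ℝ | eNorm x ≤ 1 ∧
      ∃ hx : x ≠ 0, Projectivization.mk ℝ x hx ∈ M} /
    MeasureTheory.volume {x : Fin n → ℝ | eNorm x ≤ 1}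

/-- The set `W_∞(ψ, ℚ, n)` of points of `ℙ^{n-1}(ℝ)` admitting infinitely many
rational approximations `y` with `δ_∞(x,y) ≤ ψ(H(y))`. -/
noncomputable def Winf (n : ℕ) (ψ : ℕ → ℝ) : Set (Projectivization ℝ (Fin n → ℝ)) :=
  {x | {y : Projectivization ℚ (Fin n → ℚ) | ∃ v : Fin n → ℤ, IsPrim v ∧
      (∃ hv : intRat v ≠ 0, y = Projectivization.mk ℚ (intRat v) hv) ∧
      deltaInf x.rep (intReal v) ≤ ψ (Hsup v)}.Infinite}

/-- The Choi–Vaaler constant `c(n) = 2·π^{-1/2}·Γ(n/2+1)^{1/n}` for `k = ℚ`. -/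
noncomputable def cCV (n : ℕ) : ℝ :=
  2 * Real.pi ^ (-(1/2 : ℝ)) * Real.Gamma ((n : ℝ) / 2 + 1) ^ ((1 : ℝ) / n)

/-- The Euclidean height of a primitive integer vector. -/
noncomputable def He {n : ℕ} (v : Fin n → ℤ) : ℝ := eNorm (intReal v)

end

section EuclideanNorm

variable {n : ℕ}

theorem eNorm_eq_norm_toLp (x : Fin n → ℝ) : eNorm x = ‖WithLp.toLp 2 x‖ := by
  simp [eNorm, EuclideanSpace.norm_eq]

theorem eNorm_smul (c : ℝ) (x : Fin n → ℝ) : eNorm (c • x) = |c| * eNorm x := by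
  rw [eNorm_eq_norm_toLp, WithLp.toLp_smul, norm_smul, ← eNorm_eq_norm_toLp, Real.norm_eq_abs]

theorem He_nonneg (v : Fin n → ℤ) : 0 ≤ He v := Real.sqrt_nonneg _

theorem He_smul (d : ℤ) (v : Fin n → ℤ) : He (d • v) = |(d : ℝ)| * He v := by
  rw [He, He, ← eNorm_smul]
  congr 1
  ext i
  simp [intReal]

theorem one_le_He {v : Fin n → ℤ} (hv : v ≠ 0) : 1 ≤ He v := by
  obtain ⟨i, hi⟩ := Function.ne_iff.1 hv
  rw [He, eNorm, Real.one_le_sqrt]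
  have h : (1 : ℝ) ≤ (intReal v i) ^ 2 := by
    have : (1 : ℤ) ≤ v i ^ 2 := Int.add_one_le_iff.2 (pow_two_pos_of_ne_zero hi)
    simp only [intReal]
    exact_mod_cast this
  exact h.trans (Finset.single_le_sum (f := fun i => (intReal v i) ^ 2)
    (fun j _ => sq_nonneg _) (Finset.mem_univ i))

theorem setOf_eNorm_le_eq_preimage (r : ℝ) :
    {x : Fin n → ℝ | eNorm x ≤ r} = WithLp.toLp 2 ⁻¹' Metric.closedBall 0 r := by
  ext x
  simp [eNorm_eq_norm_toLp]

theorem volume_setOf_eNorm_le [NeZero n] (r : ℝ) :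
    volume {x : Fin n → ℝ | eNorm x ≤ r} =
      ENNReal.ofReal r ^ n * ENNReal.ofReal (√Real.pi ^ n / Real.Gamma (n / 2 + 1)) := by
  rw [setOf_eNorm_le_eq_preimage, (PiLp.volume_preserving_toLp (Fin n)).measure_preimage
    Metric.isClosed_closedBall.measurableSet.nullMeasurableSet, EuclideanSpace.volume_closedBall,
    Fintype.card_fin]

theorem convex_setOf_eNorm_le (r : ℝ) : Convex ℝ {x : Fin n → ℝ | eNorm x ≤ r} := by
  rw [setOf_eNorm_le_eq_preimage]
  exact (convex_closedBall _ r).linear_preimage (WithLp.linearEquiv 2 ℝ (Fin n → ℝ)).symm.toLinearMap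

theorem isCompact_setOf_eNorm_le (r : ℝ) : IsCompact {x : Fin n → ℝ | eNorm x ≤ r} := by
  rw [setOf_eNorm_le_eq_preimage]
  exact (PiLp.homeomorph 2 (fun _ : Fin n => ℝ)).symm.isClosedEmbedding.isCompact_preimage
    (isCompact_closedBall _ _)

/-- Minkowski's theorem for Euclidean balls and the lattice spanned by the rows of an integer
matrix. -/
theorem exists_vecMul_eNorm_le [NeZero n] (A : Matrix (Fin n) (Fin n) ℤ) (hA : A.det ≠ 0) {r : ℝ}
    (hr : 0 ≤ r)
    (h : |(A.det : ℝ)| * 2 ^ n ≤ r ^ n * (√Real.pi ^ n / Real.Gamma (n / 2 + 1))) :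
    ∃ z : Fin n → ℤ, Matrix.vecMul z A ≠ 0 ∧ He (Matrix.vecMul z A) ≤ r := by
  set B : Matrix (Fin n) (Fin n) ℝ := A.map (Int.cast : ℤ → ℝ) with hB
  have hdet : B.det = A.det := (Int.cast_det A).symm
  have hunit : IsUnit B := by
    rw [Matrix.isUnit_iff_isUnit_det, hdet, isUnit_iff_ne_zero]
    exact_mod_cast hA
  have hli : LinearIndependent ℝ B.row := Matrix.linearIndependent_rows_iff_isUnit.2 hunit
  let b : Module.Basis (Fin n) ℝ (Fin n → ℝ) :=
    basisOfLinearIndependentOfCardEqFinrank hli (by simp)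
  have hb : (b : Fin n → Fin n → ℝ) = B.row := by simp [b]
  have hvol : volume (ZSpan.fundamentalDomain b) = ENNReal.ofReal |(A.det : ℝ)| := by
    rw [ZSpan.volume_fundamentalDomain, hb, ← hdet]
    rfl
  have : Countable (Submodule.span ℤ (Set.range b)).toAddSubgroup :=
    inferInstanceAs (Countable (Submodule.span ℤ (Set.range b)))
  have : DiscreteTopology (Submodule.span ℤ (Set.range b)).toAddSubgroup :=
    inferInstanceAs (DiscreteTopology (Submodule.span ℤ (Set.range b)))
  obtain ⟨w, hw0, hw⟩ := exists_ne_zero_mem_lattice_of_measure_mul_two_pow_le_measure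
    (μ := volume) (L := (Submodule.span ℤ (Set.range b)).toAddSubgroup)
    (ZSpan.isAddFundamentalDomain b volume) (s := {x : Fin n → ℝ | eNorm x ≤ r})
    (fun x hx => by simpa [eNorm] using hx) (convex_setOf_eNorm_le r)
    (isCompact_setOf_eNorm_le r) (by
      rw [hvol, volume_setOf_eNorm_le, ← ENNReal.ofReal_pow hr,
        ← ENNReal.ofReal_mul (by positivity), Module.finrank_fin_fun]
      calc ENNReal.ofReal |(A.det : ℝ)| * 2 ^ n
          = ENNReal.ofReal (|(A.det : ℝ)| * 2 ^ n) := by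
            rw [ENNReal.ofReal_mul (abs_nonneg _), ENNReal.ofReal_pow zero_le_two,
              ENNReal.ofReal_ofNat]
        _ ≤ _ := ENNReal.ofReal_le_ofReal h)
  obtain ⟨z, hz⟩ := (Submodule.mem_span_range_iff_exists_fun ℤ).1 w.2
  have hwz : (w : Fin n → ℝ) = intReal (Matrix.vecMul z A) := by
    rw [← hz, hb]
    ext i
    simp [intReal, Matrix.vecMul, dotProduct, hB, Matrix.row]
  refine ⟨z, fun h0 => hw0 ?_, ?_⟩
  · ext i
    simp [hwz, h0, intReal]
  · rw [He, ← hwz]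
    exact hw

end EuclideanNorm

theorem cCV_pos (n : ℕ) : 0 < cCV n := by
  have := Real.Gamma_pos_of_pos (show (0 : ℝ) < (n : ℝ) / 2 + 1 by positivity)
  have := Real.pi_pos
  unfold cCV
  positivity

theorem cCV_pow {n : ℕ} (hn : n ≠ 0) :
    cCV n ^ n * (√Real.pi ^ n / Real.Gamma (n / 2 + 1)) = 2 ^ n := by
  have hG := Real.Gamma_pos_of_pos (show (0 : ℝ) < (n : ℝ) / 2 + 1 by positivity)
  have hs : 0 < √Real.pi := Real.sqrt_pos.2 Real.pi_pos
  rw [cCV, mul_pow, mul_pow, one_div (n : ℝ), Real.rpow_inv_natCast_pow hG.le hn,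
    Real.rpow_neg Real.pi_pos.le, ← Real.sqrt_eq_rpow, inv_pow]
  field_simp

theorem IsPrim.ne_zero {n : ℕ} {v : Fin n → ℤ} (hv : IsPrim v) : v ≠ 0 := by
  rintro rfl
  have : Finset.univ.gcd (0 : Fin n → ℤ) = 0 := Finset.gcd_eq_zero_iff.2 fun _ _ => rfl
  rw [IsPrim, this] at hv
  exact zero_ne_one hv

theorem exists_isPrim_smul {n : ℕ} {y : Fin n → ℤ} (hy : y ≠ 0) :
    ∃ (d : ℕ) (v : Fin n → ℤ), d ≠ 0 ∧ IsPrim v ∧ y = (d : ℤ) • v := by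
  obtain ⟨i, -⟩ := Function.ne_iff.1 hy
  obtain ⟨v, hv, hg⟩ := Finset.extract_gcd y (s := Finset.univ) ⟨i, Finset.mem_univ i⟩
  have hnn : 0 ≤ Finset.univ.gcd y := Int.nonneg_of_normalize_eq_self Finset.normalize_gcd
  obtain ⟨d, hd⟩ := Int.eq_ofNat_of_zero_le hnn
  have hyv : y = (d : ℤ) • v := by
    ext j
    rw [hv j (Finset.mem_univ j), hd]
    rfl
  refine ⟨d, v, ?_, hg, hyv⟩
  rintro rfl
  exact hy (by simpa using hyv)

section Padic

variable {p : ℕ} [Fact p.Prime] {n : ℕ}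

theorem IsPrim.norm_intPadic {v : Fin n → ℤ} (hv : IsPrim v) : ‖intPadic p v‖ = 1 := by
  refine le_antisymm ((pi_norm_le_iff_of_nonneg zero_le_one).2 fun i => Padic.norm_int_le_one _) ?_
  by_contra! h
  have hdvd : (p : ℤ) ∣ Finset.univ.gcd v := Finset.dvd_gcd fun i _ =>
    Padic.norm_intCast_lt_one_iff.1 ((norm_le_pi_norm (intPadic p v) i).trans_lt h)
  rw [hv] at hdvd
  exact (Nat.prime_iff_prime_int.1 Fact.out).not_dvd_one hdvd

theorem padicDelta_smul_left {c : ℚ_[p]} (hc : c ≠ 0) (x y : Fin n → ℚ_[p]) :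
    padicDelta p (c • x) y = padicDelta p x y := by
  have h (ij : Fin n × Fin n) : ‖(c • x) ij.1 * y ij.2 - (c • x) ij.2 * y ij.1‖ =
      ‖c‖ * ‖x ij.1 * y ij.2 - x ij.2 * y ij.1‖ := by
    rw [← norm_mul]
    simp only [Pi.smul_apply, smul_eq_mul]
    ring_nf
  unfold padicDelta
  simp_rw [h]
  rw [← Real.mul_iSup_of_nonneg (norm_nonneg c), norm_smul, mul_assoc,
    mul_div_mul_left _ _ (norm_ne_zero_iff.2 hc)]

theorem padicDelta_comm (x y : Fin n → ℚ_[p]) : padicDelta p x y = padicDelta p y x := by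
  unfold padicDelta
  rw [mul_comm ‖x‖]
  congr 2
  ext ij
  rw [norm_sub_rev]
  ring_nf

theorem padicDelta_le [NeZero n] {x y : Fin n → ℚ_[p]} {r : ℝ} (hx : ‖x‖ = 1) (hy : ‖y‖ = 1)
    (h : ∀ i j, ‖x i * y j - x j * y i‖ ≤ r) : padicDelta p x y ≤ r := by
  rw [padicDelta, hx, hy, mul_one, div_one]
  exact ciSup_le fun ij => h _ _

theorem padicDelta_pos {x y : Fin n → ℚ_[p]} (hx : x ≠ 0) (hy : y ≠ 0) {i j : Fin n}
    (h : x i * y j ≠ x j * y i) : 0 < padicDelta p x y := by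
  have hle := le_ciSup (f := fun ij : Fin n × Fin n => ‖x ij.1 * y ij.2 - x ij.2 * y ij.1‖)
    (Set.finite_range _).bddAbove (i, j)
  have hpos : 0 < ‖x i * y j - x j * y i‖ := norm_pos_iff.2 (sub_ne_zero.2 h)
  exact div_pos (hpos.trans_le hle) (mul_pos (norm_pos_iff.2 hx) (norm_pos_iff.2 hy))

theorem padicDelta_ratCast_pos {x : Fin n → ℚ_[p]} (hx0 : x ≠ 0)
    (hx : ¬ ∃ (v : Fin n → ℚ) (c : ℚ_[p]), c ≠ 0 ∧ x = c • fun i => ((v i : ℚ) : ℚ_[p]))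
    {v : Fin n → ℚ} (hv : v ≠ 0) : 0 < padicDelta p x fun i => (v i : ℚ_[p]) := by
  obtain ⟨j, hj⟩ := Function.ne_iff.1 hv
  have hj' : (v j : ℚ_[p]) ≠ 0 := Rat.cast_ne_zero.2 hj
  have hv' : (fun i => (v i : ℚ_[p])) ≠ 0 := fun h => hj' (congrFun h j)
  by_contra hneg
  have heq (i : Fin n) : x i * v j = x j * v i := by
    by_contra h
    exact hneg (padicDelta_pos hx0 hv' h)
  have hxv : x = (x j / v j) • fun i => ((v i : ℚ) : ℚ_[p]) := by
    ext i
    rw [Pi.smul_apply, smul_eq_mul, div_mul_eq_mul_div, eq_div_iff hj', heq]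
  refine hx ⟨v, x j / v j, fun h0 => hx0 ?_, hxv⟩
  rw [hxv, h0, zero_smul]

theorem exists_int_norm_sub_le {z : ℚ_[p]} (hz : ‖z‖ ≤ 1) (m : ℕ) :
    ∃ a : ℤ, ‖z - a‖ ≤ ((p : ℝ) ^ m)⁻¹ := by
  obtain ⟨z, rfl⟩ : ∃ w : ℤ_[p], (w : ℚ_[p]) = z := ⟨⟨z, hz⟩, rfl⟩
  refine ⟨(PadicInt.appr z m : ℕ), ?_⟩
  rw [Int.cast_natCast]
  have h := (PadicInt.norm_le_pow_iff_mem_span_pow _ m).2 (PadicInt.appr_spec m z)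
  rwa [zpow_neg, zpow_natCast, PadicInt.norm_def, PadicInt.coe_sub, PadicInt.coe_natCast] at h

theorem norm_natCast_pow_self (m : ℕ) : ‖((p : ℚ_[p]) ^ m)‖ = ((p : ℝ) ^ m)⁻¹ := by
  rw [norm_pow, Padic.norm_p, inv_pow]

/-- Integer vectors `y` with all `2 × 2` minors of `(x, y)` of norm at most `p ^ (-m)`: a lattice
of index `p ^ (m * (n - 1))`, to which Minkowski's theorem is applied. -/
theorem exists_int_minors_le [NeZero n] {x : Fin n → ℚ_[p]} {k : Fin n} (hk : x k = 1)
    (hx : ∀ i, ‖x i‖ ≤ 1) (m : ℕ) :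
    ∃ y : Fin n → ℤ, y ≠ 0 ∧ (He y) ^ n ≤ cCV n ^ n * ((p : ℝ) ^ m) ^ (n - 1) ∧
      ∀ i j, ‖x i * intPadic p y j - x j * intPadic p y i‖ ≤ ((p : ℝ) ^ m)⁻¹ := by
  have hp : (0 : ℝ) < (p : ℝ) ^ m := pow_pos (mod_cast (Fact.out : p.Prime).pos) m
  have hn : n ≠ 0 := NeZero.ne n
  choose a' ha' using fun i => exists_int_norm_sub_le (hx i) m
  set a : Fin n → ℤ := Function.update a' k 1 with ha_def
  have ha (i : Fin n) : ‖x i - a i‖ ≤ ((p : ℝ) ^ m)⁻¹ := by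
    rcases eq_or_ne i k with rfl | hik
    · simp [ha_def, hk]
    · simpa [ha_def, hik] using ha' i
  have hak : a k = 1 := by simp [ha_def]
  set A : Matrix (Fin n) (Fin n) ℤ :=
    (Matrix.diagonal fun _ => (p : ℤ) ^ m).updateRow k a with hA
  have hdet : A.det = ((p : ℤ) ^ m) ^ (n - 1) := by
    rw [hA, ← Matrix.cramer_transpose_apply, Matrix.diagonal_transpose,
      Matrix.cramer_eq_adjugate_mulVec, Matrix.adjugate_diagonal, Matrix.mulVec_diagonal, hak,
      mul_one, Finset.prod_const, Finset.card_erase_of_mem (Finset.mem_univ k), Finset.card_univ,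
      Fintype.card_fin]
  have hdet' : |(A.det : ℝ)| = ((p : ℝ) ^ m) ^ (n - 1) := by
    rw [hdet]
    push_cast
    exact abs_of_pos (pow_pos hp _)
  have hdet0 : A.det ≠ 0 := by
    intro h0
    rw [h0, Int.cast_zero, abs_zero] at hdet'
    exact (pow_pos hp (n - 1)).ne hdet'
  set R : ℝ := cCV n * (((p : ℝ) ^ m) ^ (n - 1)) ^ ((n : ℝ)⁻¹) with hR
  have hRn : R ^ n = cCV n ^ n * ((p : ℝ) ^ m) ^ (n - 1) := by
    rw [hR, mul_pow, Real.rpow_inv_natCast_pow (pow_pos hp _).le hn]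
  have hR0 : 0 ≤ R := mul_nonneg (cCV_pos n).le (Real.rpow_nonneg (pow_pos hp _).le _)
  obtain ⟨z, hz0, hz⟩ := exists_vecMul_eNorm_le A hdet0 hR0 (by
    rw [hdet', hRn, mul_right_comm, cCV_pow hn, mul_comm])
  refine ⟨_, hz0, hRn ▸ pow_le_pow_left₀ (He_nonneg _) hz n, ?_⟩
  set y := Matrix.vecMul z A with hy
  have hyi (i : Fin n) : ∃ t : ℤ, y i = z k * a i + t * (p : ℤ) ^ m := by
    rw [hy, Matrix.vecMul, dotProduct, ← Finset.add_sum_erase _ _ (Finset.mem_univ k)]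
    rcases eq_or_ne i k with rfl | hik
    · refine ⟨0, ?_⟩
      rw [Finset.sum_eq_zero]
      · simp [hA]
      · intro j hj
        simp [hA, Matrix.updateRow_ne (Finset.ne_of_mem_erase hj),
          Matrix.diagonal_apply_ne _ (Finset.ne_of_mem_erase hj)]
    · refine ⟨z i, ?_⟩
      rw [Finset.sum_eq_single_of_mem i (by simp [hik])]
      · simp [hA, Matrix.updateRow_ne hik]
      · intro j hj hji
        simp [hA, Matrix.updateRow_ne (Finset.ne_of_mem_erase hj), Matrix.diagonal_apply_ne _ hji]
  have hclose (i : Fin n) : ‖intPadic p y i - z k * x i‖ ≤ ((p : ℝ) ^ m)⁻¹ := by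
    obtain ⟨t, ht⟩ := hyi i
    have : intPadic p y i - z k * x i =
        (t : ℚ_[p]) * (p : ℚ_[p]) ^ m + -((z k : ℚ_[p]) * (x i - a i)) := by
      rw [intPadic, ht]
      push_cast
      ring
    rw [this]
    refine (Padic.nonarchimedean _ _).trans (max_le ?_ ?_)
    · rw [norm_mul, norm_natCast_pow_self]
      exact mul_le_of_le_one_left (inv_pos.2 hp).le (Padic.norm_int_le_one _)
    · rw [norm_neg, norm_mul]
      exact (mul_le_of_le_one_left (norm_nonneg _) (Padic.norm_int_le_one _)).trans (ha i)
  intro i j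
  have : x i * intPadic p y j - x j * intPadic p y i =
      x i * (intPadic p y j - z k * x j) + -(x j * (intPadic p y i - z k * x i)) := by ring
  rw [this]
  refine (Padic.nonarchimedean _ _).trans (max_le ?_ ?_)
  · rw [norm_mul]
    exact (mul_le_of_le_one_left (norm_nonneg _) (hx i)).trans (hclose j)
  · rw [norm_neg, norm_mul]
    exact (mul_le_of_le_one_left (norm_nonneg _) (hx j)).trans (hclose i)

theorem inv_natCast_le_norm {d : ℕ} (hd : d ≠ 0) : (d : ℝ)⁻¹ ≤ ‖(d : ℚ_[p])‖ := by
  have hp : (0 : ℝ) < p := mod_cast (Fact.out : p.Prime).pos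
  have h : ‖(d : ℚ_[p])‖ = ((p : ℝ) ^ padicValNat p d)⁻¹ := by
    rw [Padic.norm_eq_zpow_neg_valuation (Nat.cast_ne_zero.2 hd), Padic.valuation_natCast,
      zpow_neg, zpow_natCast]
  rw [h]
  refine inv_anti₀ (pow_pos hp _) ?_
  exact_mod_cast Nat.le_of_dvd (Nat.pos_of_ne_zero hd) pow_padicValNat_dvd

theorem exists_isPrim_padicDelta_le [NeZero n] {x : Fin n → ℚ_[p]} (hx0 : x ≠ 0) (m : ℕ) :
    ∃ (d : ℕ) (v : Fin n → ℤ), d ≠ 0 ∧ IsPrim v ∧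
      (d * He v) ^ n ≤ cCV n ^ n * ((p : ℝ) ^ m) ^ (n - 1) ∧
      padicDelta p x (intPadic p v) ≤ ((p : ℝ) ^ m)⁻¹ * d := by
  obtain ⟨k, hk⟩ := exists_eq_ciSup_of_finite (f := fun i => ‖x i‖)
  have hle (i : Fin n) : ‖x i‖ ≤ ‖x k‖ := by
    rw [hk]
    exact le_ciSup (f := fun i => ‖x i‖) (Set.finite_range _).bddAbove i
  have hk0 : x k ≠ 0 := by
    intro h
    refine hx0 (funext fun i => norm_le_zero_iff.1 ?_)
    simpa [h] using hle i
  set u : Fin n → ℚ_[p] := (x k)⁻¹ • x with hu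
  have huk : u k = 1 := inv_mul_cancel₀ hk0
  have hu1 (i : Fin n) : ‖u i‖ ≤ 1 := by
    rw [hu, Pi.smul_apply, smul_eq_mul, norm_mul, norm_inv, inv_mul_eq_div]
    exact div_le_one_of_le₀ (hle i) (norm_nonneg _)
  have hunorm : ‖u‖ = 1 := by
    refine le_antisymm ((pi_norm_le_iff_of_nonneg zero_le_one).2 hu1) ?_
    simpa [huk] using norm_le_pi_norm u k
  obtain ⟨y, hy0, hyH, hy⟩ := exists_int_minors_le huk hu1 m
  obtain ⟨d, v, hd, hv, rfl⟩ := exists_isPrim_smul hy0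
  refine ⟨d, v, hd, hv, by rwa [He_smul, Int.cast_natCast, Nat.abs_cast] at hyH, ?_⟩
  rw [← padicDelta_smul_left (inv_ne_zero hk0)]
  refine padicDelta_le hunorm hv.norm_intPadic fun i j => ?_
  have hd0 : (0 : ℝ) < d := mod_cast Nat.pos_of_ne_zero hd
  have h : ‖(d : ℚ_[p])‖ * ‖u i * intPadic p v j - u j * intPadic p v i‖ ≤ ((p : ℝ) ^ m)⁻¹ := by
    rw [← norm_mul]
    convert hy i j using 2
    simp only [intPadic, Pi.smul_apply, smul_eq_mul]
    push_cast
    ring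
  rw [← div_le_iff₀ hd0, div_eq_inv_mul]
  exact (mul_le_mul_of_nonneg_right (inv_natCast_le_norm hd) (norm_nonneg _)).trans h

end Padic

/-- Extraction of the exponent `n / (n - 1)` from the bound given by Minkowski's theorem. -/
theorem inv_mul_le_rpow_of_pow_le {n : ℕ} (hn : 2 ≤ n) {c q d h : ℝ} (hc : 0 ≤ c) (hq : 0 < q)
    (hd : 1 ≤ d) (hh : 0 < h) (hle : (d * h) ^ n ≤ c ^ n * q ^ (n - 1)) :
    q⁻¹ * d ≤ c ^ ((n : ℝ) / ((n : ℝ) - 1)) * h ^ (-((n : ℝ) / ((n : ℝ) - 1))) := by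
  have hn1 : (0 : ℝ) < (n : ℝ) - 1 := by
    have : (2 : ℝ) ≤ n := mod_cast hn
    linarith
  set e : ℝ := (n : ℝ) / ((n : ℝ) - 1) with he
  have he1 : 1 ≤ e := (one_le_div hn1).2 (by linarith)
  have hd0 : 0 < d := zero_lt_one.trans_le hd
  have hroot := Real.rpow_le_rpow (by positivity) hle (inv_pos.2 hn1).le
  have hcast : ((n - 1 : ℕ) : ℝ) = (n : ℝ) - 1 := by
    rw [Nat.cast_sub (by omega), Nat.cast_one]
  rw [Real.mul_rpow (by positivity) (by positivity), ← Real.rpow_natCast, ← Real.rpow_natCast,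
    ← Real.rpow_natCast, ← Real.rpow_mul (by positivity), ← Real.rpow_mul hc,
    ← Real.rpow_mul hq.le, hcast, mul_inv_cancel₀ hn1.ne', Real.rpow_one, ← div_eq_mul_inv,
    ← he, Real.mul_rpow hd0.le hh.le] at hroot
  have hde : d ≤ d ^ e := by
    simpa using Real.rpow_le_rpow_of_exponent_le hd he1
  have hhe : 0 < h ^ e := Real.rpow_pos_of_pos hh e
  rw [Real.rpow_neg hh.le, ← div_eq_mul_inv, le_div_iff₀ hhe, inv_mul_eq_div, div_mul_eq_mul_div,
    div_le_iff₀ hq]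
  exact (mul_le_mul_of_nonneg_right hde hhe.le).trans hroot

theorem pow_inv_mul_le_of_pow_le {n : ℕ} (hn : n ≠ 0) {c q d h : ℝ} (hq : 0 < q)
    (hd : 0 ≤ d) (hh : 1 ≤ h) (hle : (d * h) ^ n ≤ c ^ n * q ^ (n - 1)) :
    (q⁻¹ * d) ^ n ≤ c ^ n * q⁻¹ := by
  have h1 : d ^ n ≤ c ^ n * q ^ (n - 1) :=
    (pow_le_pow_left₀ hd (le_mul_of_one_le_right hd hh) n).trans hle
  calc (q⁻¹ * d) ^ n = (q ^ n)⁻¹ * d ^ n := by rw [mul_pow, inv_pow]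
    _ ≤ (q ^ n)⁻¹ * (c ^ n * q ^ (n - 1)) := by gcongr
    _ = c ^ n * q⁻¹ := by
      obtain ⟨k, rfl⟩ := Nat.exists_eq_succ_of_ne_zero hn
      rw [Nat.succ_sub_one, pow_succ q]
      field_simp

/-- for irrational points of `ℙ^{n-1}(ℚ_p)` there are infinitely many rational
points `y` with `δ_p(x,y) ≤ c(n)^{n/(n-1)} H_e(y)^{-n/(n-1)}`. -/
theorem projective_dirichlet_corollary (n p : ℕ) (hn : 2 ≤ n) [Fact p.Prime]
    (x : Projectivization ℚ_[p] (Fin n → ℚ_[p]))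
    (hx : ¬ ∃ (v : Fin n → ℚ) (c : ℚ_[p]), c ≠ 0 ∧
      x.rep = c • fun i => ((v i : ℚ) : ℚ_[p])) :
    {y : Projectivization ℚ (Fin n → ℚ) | ∃ v : Fin n → ℤ, IsPrim v ∧
      (∃ hv : intRat v ≠ 0, y = Projectivization.mk ℚ (intRat v) hv) ∧
      padicDelta p x.rep (intPadic p v) ≤
        cCV n ^ ((n : ℝ) / ((n : ℝ) - 1)) * He v ^ (-((n : ℝ) / ((n : ℝ) - 1)))}.Infinite := by
  have hn0 : n ≠ 0 := by omega
  have : NeZero n := ⟨hn0⟩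
  have hp1 : (1 : ℝ) < p := mod_cast (Fact.out : p.Prime).one_lt
  set F : Projectivization ℚ (Fin n → ℚ) → ℝ :=
    fun y => padicDelta p x.rep fun i => (y.rep i : ℚ_[p]) with hF
  have hFpos (y) : 0 < F y := padicDelta_ratCast_pos x.rep_nonzero hx y.rep_nonzero
  have hFmk (v : Fin n → ℤ) (hv : intRat v ≠ 0) :
      F (Projectivization.mk ℚ (intRat v) hv) = padicDelta p x.rep (intPadic p v) := by
    obtain ⟨a, ha⟩ := Projectivization.exists_smul_eq_mk_rep ℚ (intRat v) hv
    have h : (fun i => ((Projectivization.mk ℚ (intRat v) hv).rep i : ℚ_[p])) =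
        ((a : ℚ) : ℚ_[p]) • intPadic p v := by
      ext i
      simp [← ha, intPadic, intRat, Units.smul_def]
    simp only [hF]
    rw [h, padicDelta_comm, padicDelta_smul_left (Rat.cast_ne_zero.2 a.ne_zero), padicDelta_comm]
  intro hfin
  have hsmall : ∀ ε > 0, ∃ y ∈ {y : Projectivization ℚ (Fin n → ℚ) | ∃ v : Fin n → ℤ, IsPrim v ∧
      (∃ hv : intRat v ≠ 0, y = Projectivization.mk ℚ (intRat v) hv) ∧
      padicDelta p x.rep (intPadic p v) ≤
        cCV n ^ ((n : ℝ) / ((n : ℝ) - 1)) * He v ^ (-((n : ℝ) / ((n : ℝ) - 1)))}, F y < ε := by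
    intro ε hε
    obtain ⟨m, hm⟩ := pow_unbounded_of_one_lt (cCV n ^ n / ε ^ n) hp1
    have hq : (0 : ℝ) < (p : ℝ) ^ m := pow_pos (zero_lt_one.trans hp1) m
    obtain ⟨d, v, hd, hv, hH, hδ⟩ := exists_isPrim_padicDelta_le (p := p) x.rep_nonzero m
    have hv0 : intRat v ≠ 0 := fun h => hv.ne_zero <| funext fun i => by
      simpa [intRat] using congrFun h i
    have hd1 : (1 : ℝ) ≤ d := mod_cast Nat.one_le_iff_ne_zero.2 hd
    have hH1 := one_le_He hv.ne_zero
    refine ⟨_, ⟨v, hv, ⟨hv0, rfl⟩, hδ.trans ?_⟩, ?_⟩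
    · exact inv_mul_le_rpow_of_pow_le hn (cCV_pos n).le hq hd1 (zero_lt_one.trans_le hH1) hH
    · rw [hFmk]
      refine hδ.trans_lt (lt_of_pow_lt_pow_left₀ n hε.le ?_)
      refine (pow_inv_mul_le_of_pow_le hn0 hq (by positivity) hH1 hH).trans_lt ?_
      rw [← div_eq_mul_inv, div_lt_iff₀ hq, mul_comm, ← div_lt_iff₀ (pow_pos hε n)]
      exact hm
  obtain ⟨y₁, hy₁, -⟩ := hsmall 1 one_pos
  obtain ⟨y₀, -, hmin⟩ := Set.exists_min_image _ F hfin ⟨y₁, hy₁⟩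
  obtain ⟨y, hy, hlt⟩ := hsmall (F y₀) (hFpos y₀)
  exact absurd (hmin y hy) hlt.not_ge
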